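/- Let n ≥ 1, let U ⊆ ℝⁿ be an open set with ℝ^{>0}·U ⊆ U, let k > 1 be real, let h : U → ℝ be smooth, positive, and positively homogeneous of degree k, and assume that for every x ∈ U the restriction of g_U(x) = −(D²h)ₓ to ker((Dh)ₓ) is positive definite. For c ∈ ℝ define U_c = {x ∈ U : h(x) + c > 0} if c ≤ 0 and U_c = {x ∈ U : h(x) − c(k−1) > 0} if c > 0. Then for every x ∈ U_c the symmetric bilinear form g'_c(x) := −(D²(log(h+c)))ₓ satisfies g'_c(x) = (1/(h(x)+c))·ǧ(x) + ((h(x)−c(k−1))/(k·h(x)))·(1/(h(x)+c)²)·(Dh)ₓ ⊗ (Dh)ₓ, and g'_c(x) is positive definite. -/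

import Mathlib

noncomputable section

/-- The second derivative of `f` at `x`, as a bilinear form: `(D²f)ₓ(u, v)`. -/
def D2 {n : ℕ} (f : (Fin n → ℝ) → ℝ) (x u v : Fin n → ℝ) : ℝ :=
  fderiv ℝ (fderiv ℝ f) x u v

/-- The symmetric bilinear form `g_U(x) = −(D²h)ₓ`. -/
def gU {n : ℕ} (h : (Fin n → ℝ) → ℝ) (x u v : Fin n → ℝ) : ℝ := -D2 h x u v

/-- The symmetric bilinear form
`ǧ(x)(u, v) = g_U(x)(u, v) − g_U(x)(x, u)·g_U(x)(x, v)/g_U(x)(x, x)`. -/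
def gcheck {n : ℕ} (h : (Fin n → ℝ) → ℝ) (x u v : Fin n → ℝ) : ℝ :=
  gU h x u v - gU h x x u * gU h x x v / gU h x x x

/-- The symmetric bilinear form `g'_c(x) = −(D²(log(h+c)))ₓ`. -/
def gprimec {n : ℕ} (h : (Fin n → ℝ) → ℝ) (c : ℝ) (x u v : Fin n → ℝ) : ℝ :=
  -D2 (fun y => Real.log (h y + c)) x u v

/-- The domain `U_c`: `{x ∈ U : h(x) + c > 0}` for `c ≤ 0`, and
`{x ∈ U : h(x) − c(k−1) > 0}` for `c > 0`. -/
def Uc {n : ℕ} (h : (Fin n → ℝ) → ℝ) (U : Set (Fin n → ℝ)) (k c : ℝ) :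
    Set (Fin n → ℝ) :=
  if c ≤ 0 then {x ∈ U | 0 < h x + c} else {x ∈ U | 0 < h x - c * (k - 1)}

section EulerIdentities

open Filter Topology

variable {E : Type*} [NormedAddCommGroup E] [NormedSpace ℝ E]

/-- Euler's identity for a positively homogeneous function. -/
theorem fderiv_apply_self_of_homogeneous {h : E → ℝ} {k : ℝ} {x : E}
    (hd : DifferentiableAt ℝ h x) (hhom : ∀ l : ℝ, 0 < l → h (l • x) = l ^ k * h x) :
    fderiv ℝ h x x = k * h x := by
  have hline : HasDerivAt (fun l : ℝ => l • x) x 1 := by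
    simpa using (hasDerivAt_id (1 : ℝ)).smul_const x
  have hd' : HasFDerivAt h (fderiv ℝ h x) ((1 : ℝ) • x) := by
    simpa using hd.hasFDerivAt
  have hleft : HasDerivAt (fun l : ℝ => h (l • x)) (fderiv ℝ h x x) 1 :=
    hd'.comp_hasDerivAt (1 : ℝ) hline
  have hright : HasDerivAt (fun l : ℝ => l ^ k * h x) (k * h x) 1 := by
    simpa using (Real.hasDerivAt_rpow_const (x := 1) (p := k) (Or.inl one_ne_zero)).mul_const (h x)
  refine hleft.unique (hright.congr_of_eventuallyEq ?_)
  filter_upwards [lt_mem_nhds (zero_lt_one' ℝ)] with l hl using hhom l hl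

/-- Differentiating Euler's identity: `(D²h)ₓ(x, v) = (k - 1) (Dh)ₓ(v)`. -/
theorem fderiv_fderiv_self_apply_of_euler {h : E → ℝ} {k : ℝ} {x : E}
    (hc : ContDiffAt ℝ 2 h x) (heuler : ∀ᶠ y in 𝓝 x, fderiv ℝ h y y = k * h y) (v : E) :
    fderiv ℝ (fderiv ℝ h) x x v = (k - 1) * fderiv ℝ h x v := by
  have hsymm : IsSymmSndFDerivAt ℝ h x := hc.isSymmSndFDerivAt (by simp)
  have hdd : DifferentiableAt ℝ (fderiv ℝ h) x :=
    (hc.fderiv_right (m := 1) (by norm_num)).differentiableAt (by norm_num)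
  have hd : DifferentiableAt ℝ h x := hc.differentiableAt (by norm_num)
  have hleft := hdd.hasFDerivAt.clm_apply (hasFDerivAt_id x)
  have hright := (hd.hasFDerivAt.const_mul k).congr_of_eventuallyEq heuler
  have key := congrArg (fun L : E →L[ℝ] ℝ => L v) (hleft.unique hright)
  simp at key
  rw [hsymm.eq x v]
  linarith

/-- The second derivative of `log (h + c)`. -/
theorem fderiv_fderiv_log_add_const {h : E → ℝ} {c : ℝ} {x : E}
    (hc : ContDiffAt ℝ 2 h x) (hx : h x + c ≠ 0) (u v : E) :
    fderiv ℝ (fderiv ℝ fun y => Real.log (h y + c)) x u v =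
      fderiv ℝ (fderiv ℝ h) x u v / (h x + c)
        - fderiv ℝ h x u * fderiv ℝ h x v / (h x + c) ^ 2 := by
  have hdd : DifferentiableAt ℝ (fderiv ℝ h) x :=
    (hc.fderiv_right (m := 1) (by norm_num)).differentiableAt (by norm_num)
  have hd : DifferentiableAt ℝ h x := hc.differentiableAt (by norm_num)
  have hfirst : (fderiv ℝ fun y => Real.log (h y + c)) =ᶠ[𝓝 x]
      fun y => (h y + c)⁻¹ • fderiv ℝ h y := by
    filter_upwards [hc.eventually (by simp),
      (hd.continuousAt.add continuousAt_const).eventually_ne hx] with y hy hne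
    exact (((hy.differentiableAt (by norm_num)).hasFDerivAt.add_const c).log hne).fderiv
  have hinv : HasFDerivAt (fun y => (h y + c)⁻¹) (-((h x + c) ^ 2)⁻¹ • fderiv ℝ h x) x :=
    (hasDerivAt_inv hx).comp_hasFDerivAt x (hd.hasFDerivAt.add_const c)
  have key := (hinv.smul hdd.hasFDerivAt).congr_of_eventuallyEq hfirst
  rw [key.fderiv]
  simp
  field_simp
  ring

end EulerIdentities

/-- Let `h` be smooth, positive and positively homogeneous of degree `k > 1` on an
open cone `U ⊆ ℝⁿ`, with `g_U = −D²h` positive definite on `ker Dh`.  Then on `U_c`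
the form `g'_c(x) = −(D²(log(h+c)))ₓ` satisfies
`g'_c(x) = (1/(h(x)+c))·ǧ(x) + ((h(x)−c(k−1))/(k·h(x)))·(1/(h(x)+c)²)·(Dh)ₓ ⊗ (Dh)ₓ`
and is positive definite. -/
theorem stmt14 {n : ℕ} (hn : 1 ≤ n)
    (U : Set (Fin n → ℝ)) (hU : IsOpen U)
    (hcone : ∀ l : ℝ, 0 < l → ∀ x ∈ U, l • x ∈ U)
    (k : ℝ) (hk : 1 < k)
    (h : (Fin n → ℝ) → ℝ) (hsm : ContDiffOn ℝ (⊤ : ℕ∞) h U)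
    (hpos : ∀ x ∈ U, 0 < h x)
    (hhom : ∀ l : ℝ, 0 < l → ∀ x ∈ U, h (l • x) = l ^ k * h x)
    (hker : ∀ x ∈ U, ∀ v : Fin n → ℝ, fderiv ℝ h x v = 0 → v ≠ 0 → 0 < gU h x v v)
    (c : ℝ) :
    ∀ x ∈ Uc h U k c,
      (∀ u v : Fin n → ℝ,
        gprimec h c x u v
          = (1 / (h x + c)) * gcheck h x u v
            + ((h x - c * (k - 1)) / (k * h x)) * (1 / (h x + c) ^ 2)
              * (fderiv ℝ h x u * fderiv ℝ h x v)) ∧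
      (∀ v : Fin n → ℝ, v ≠ 0 → 0 < gprimec h c x v v) := by
  intro x hx
  obtain ⟨hxU, hplus, hminus⟩ : x ∈ U ∧ 0 < h x + c ∧ 0 < h x - c * (k - 1) := by
    unfold Uc at hx
    split_ifs at hx with hc
    · exact ⟨hx.1, hx.2, by nlinarith [hpos x hx.1, hx.2]⟩
    · have hpx := hpos x hx.1
      exact ⟨hx.1, by linarith, hx.2⟩
  have hhx := hpos x hxU
  have hsmooth : ∀ y ∈ U, ContDiffAt ℝ 2 h y := fun y hy =>
    (hsm.contDiffAt (hU.mem_nhds hy)).of_le (WithTop.coe_le_coe.2 (le_top : (2 : ℕ∞) ≤ ⊤))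
  have heuler : ∀ y ∈ U, fderiv ℝ h y y = k * h y := fun y hy =>
    fderiv_apply_self_of_homogeneous ((hsmooth y hy).differentiableAt (by norm_num))
      fun l hl => hhom l hl y hy
  have hself : ∀ v, gU h x x v = -((k - 1) * fderiv ℝ h x v) := fun v =>
    congrArg Neg.neg <| fderiv_fderiv_self_apply_of_euler (hsmooth x hxU)
      (Filter.eventually_of_mem (hU.mem_nhds hxU) heuler) v
  have hsymm : ∀ v, gU h x v x = gU h x x v := fun v =>
    congrArg Neg.neg <| ((hsmooth x hxU).isSymmSndFDerivAt (by simp)).eq v x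
  have hk1 : k - 1 ≠ 0 := by linarith
  have hk0 : 0 < k := by linarith
  have hcheck : ∀ u v, gcheck h x u v =
      gU h x u v + (k - 1) / (k * h x) * (fderiv ℝ h x u * fderiv ℝ h x v) := by
    intro u v
    rw [gcheck, hself, hself, hself, heuler x hxU]
    field_simp
    ring
  have hform : ∀ u v, gprimec h c x u v = (1 / (h x + c)) * gcheck h x u v
      + ((h x - c * (k - 1)) / (k * h x)) * (1 / (h x + c) ^ 2)
        * (fderiv ℝ h x u * fderiv ℝ h x v) := by
    intro u v
    rw [hcheck, gprimec, D2, fderiv_fderiv_log_add_const (hsmooth x hxU) hplus.ne', gU, D2]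
    field_simp
    ring
  refine ⟨hform, fun v hv => ?_⟩
  rw [hform]
  -- Split `v` along `ker (Dh)ₓ ⊕ ℝ x`; the second summand is the kernel of `ǧ(x)`.
  set a := fderiv ℝ h x v / (k * h x) with ha
  have hav : fderiv ℝ h x v = a * (k * h x) := by rw [ha]; field_simp
  have hwker : fderiv ℝ h x (v - a • x) = 0 := by
    rw [map_sub, map_smul, heuler x hxU, hav, smul_eq_mul, sub_self]
  have hsplit : gcheck h x v v = gU h x (v - a • x) (v - a • x) := by
    have hexpand : gU h x (v - a • x) (v - a • x) =
        gU h x v v - a * gU h x v x - a * gU h x x v + a ^ 2 * gU h x x x := by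
      simp only [gU, D2, map_sub, map_smul, sub_apply,
        smul_apply, smul_eq_mul]
      ring
    rw [hexpand, hcheck, hsymm, hself, hself, heuler x hxU, hav]
    field_simp
    ring
  rw [hsplit]
  by_cases hw : v - a • x = 0
  · have hDv : fderiv ℝ h x v ≠ 0 := by
      intro h0
      apply hv
      rw [sub_eq_zero.mp hw, ha, h0, zero_div, zero_smul]
    have hsq : 0 < fderiv ℝ h x v * fderiv ℝ h x v := mul_self_pos.mpr hDv
    have hzero : gU h x (v - a • x) (v - a • x) = 0 := by simp [hw, gU, D2]
    rw [hzero]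
    positivity
  · have hgw := hker x hxU _ hwker hw
    have hsq : 0 ≤ fderiv ℝ h x v * fderiv ℝ h x v := mul_self_nonneg _
    positivity
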